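/- arXiv:2101.00412 — 6 statements merged into one kernel-verified Lean document; each statement's English description precedes it below -/
import Mathlib

section
/- Suppose M₁₁ ≥ 0 and −M₂₂ ≥ 0. Then for every ε > 0 the operator M_ε is invertible. -/
open scoped RealInnerProductSpace

/-- The block operator `(u₁, u₂) ↦ (M₁₁u₁ + M₁₂u₂, M₂₁u₁ + M₂₂u₂)` on the product
Hilbert space `H₁ ×₂ H₂` (with the `L²` product norm). -/
noncomputable def blockOp {H₁ H₂ : Type*}
    [NormedAddCommGroup H₁] [InnerProductSpace ℝ H₁]
    [NormedAddCommGroup H₂] [InnerProductSpace ℝ H₂]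
    (M11 : H₁ →L[ℝ] H₁) (M12 : H₂ →L[ℝ] H₁)
    (M21 : H₁ →L[ℝ] H₂) (M22 : H₂ →L[ℝ] H₂) :
    WithLp 2 (H₁ × H₂) →L[ℝ] WithLp 2 (H₁ × H₂) :=
  ((WithLp.prodContinuousLinearEquiv 2 ℝ H₁ H₂).symm.toContinuousLinearMap) ∘L
    ((M11 ∘L ContinuousLinearMap.fst ℝ H₁ H₂ + M12 ∘L ContinuousLinearMap.snd ℝ H₁ H₂).prod
      (M21 ∘L ContinuousLinearMap.fst ℝ H₁ H₂ + M22 ∘L ContinuousLinearMap.snd ℝ H₁ H₂)) ∘L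
    ((WithLp.prodContinuousLinearEquiv 2 ℝ H₁ H₂).toContinuousLinearMap)

/-- **Lax–Milgram** for operators: a coercive bounded operator on a real Hilbert space is a
continuous linear equivalence. -/
theorem exists_continuousLinearEquiv_of_coercive {H : Type*}
    [NormedAddCommGroup H] [InnerProductSpace ℝ H] [CompleteSpace H]
    (T : H →L[ℝ] H) {c : ℝ} (hc : 0 < c) (hT : ∀ u, c * ‖u‖ ^ 2 ≤ ⟪T u, u⟫) :
    ∃ e : H ≃L[ℝ] H, ∀ u, e u = T u := by
  have hB : IsCoercive ((innerSL ℝ).comp T) :=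
    ⟨c, hc, fun u => by simpa [pow_two, mul_assoc] using hT u⟩
  refine ⟨hB.continuousLinearEquivOfBilin, fun u => ext_inner_right ℝ fun w => ?_⟩
  simp [hB.continuousLinearEquivOfBilin_apply]

section blockOp

variable {H₁ H₂ : Type*}
  [NormedAddCommGroup H₁] [InnerProductSpace ℝ H₁]
  [NormedAddCommGroup H₂] [InnerProductSpace ℝ H₂]

theorem blockOp_apply (M11 : H₁ →L[ℝ] H₁) (M12 : H₂ →L[ℝ] H₁)
    (M21 : H₁ →L[ℝ] H₂) (M22 : H₂ →L[ℝ] H₂) (u : WithLp 2 (H₁ × H₂)) :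
    blockOp M11 M12 M21 M22 u =
      WithLp.toLp 2 (M11 u.fst + M12 u.snd, M21 u.fst + M22 u.snd) :=
  rfl

theorem inner_blockOp_apply_self (M11 : H₁ →L[ℝ] H₁) (M12 : H₂ →L[ℝ] H₁)
    (M21 : H₁ →L[ℝ] H₂) (M22 : H₂ →L[ℝ] H₂) (u : WithLp 2 (H₁ × H₂)) :
    ⟪blockOp M11 M12 M21 M22 u, u⟫ =
      ⟪M11 u.fst, u.fst⟫ + ⟪M12 u.snd, u.fst⟫ + (⟪M21 u.fst, u.snd⟫ + ⟪M22 u.snd, u.snd⟫) := by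
  simp [blockOp_apply, WithLp.prod_inner_apply, inner_add_left]

end blockOp

/-- If `M₁₁ ≥ 0` and `−M₂₂ ≥ 0`, then for every `ε > 0` the perturbed block operator
`M_ε(u₁,u₂) = (M₁₁u₁ + M₁₂u₂ + εu₁, M₂₁u₁ + M₂₂u₂ − εu₂)` is invertible
(bijective with a continuous linear inverse). -/
theorem perturbed_block_operator_invertible {H₁ H₂ : Type*}
    [NormedAddCommGroup H₁] [InnerProductSpace ℝ H₁] [CompleteSpace H₁]
    [NormedAddCommGroup H₂] [InnerProductSpace ℝ H₂] [CompleteSpace H₂]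
    (M11 : H₁ →L[ℝ] H₁) (M12 : H₂ →L[ℝ] H₁)
    (M21 : H₁ →L[ℝ] H₂) (M22 : H₂ →L[ℝ] H₂)
    (h21 : M21 = ContinuousLinearMap.adjoint M12)
    (h11sa : IsSelfAdjoint M11) (h22sa : IsSelfAdjoint M22)
    (h11pos : ∀ u₁ : H₁, 0 ≤ ⟪M11 u₁, u₁⟫)
    (h22neg : ∀ u₂ : H₂, 0 ≤ ⟪(-M22) u₂, u₂⟫)
    (ε : ℝ) (hε : 0 < ε) :
    ∃ S : WithLp 2 (H₁ × H₂) →L[ℝ] WithLp 2 (H₁ × H₂),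
      S ∘L blockOp (M11 + ε • ContinuousLinearMap.id ℝ H₁) M12 M21
          (M22 - ε • ContinuousLinearMap.id ℝ H₂) = ContinuousLinearMap.id ℝ _ ∧
      blockOp (M11 + ε • ContinuousLinearMap.id ℝ H₁) M12 M21
          (M22 - ε • ContinuousLinearMap.id ℝ H₂) ∘L S = ContinuousLinearMap.id ℝ _ := by
  let J : WithLp 2 (H₁ × H₂) →L[ℝ] WithLp 2 (H₁ × H₂) :=
    blockOp (.id ℝ H₁) 0 0 (-.id ℝ H₂)
  obtain ⟨e, he⟩ := exists_continuousLinearEquiv_of_coercive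
    (blockOp (M11 + ε • .id ℝ H₁) M12 (-M21) (-(M22 - ε • .id ℝ H₂))) hε fun u => by
      have h1 := h11pos u.fst
      have h2 := h22neg u.snd
      have h3 : ⟪M21 u.fst, u.snd⟫ = ⟪M12 u.snd, u.fst⟫ := by
        rw [h21, ContinuousLinearMap.adjoint_inner_left, real_inner_comm]
      rw [inner_blockOp_apply_self, WithLp.prod_norm_sq_eq_of_L2]
      simp only [add_apply, sub_apply,
        neg_apply, smul_apply,
        ContinuousLinearMap.id_apply, inner_add_left, inner_sub_left, inner_neg_left,
        real_inner_smul_left, real_inner_self_eq_norm_sq] at h2 ⊢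
      linarith
  have hJ : ∀ u, J (J u) = u := fun u => by
    simp only [J, blockOp_apply]
    simp
    rfl
  have hJM : ∀ u, J (blockOp (M11 + ε • .id ℝ H₁) M12 M21 (M22 - ε • .id ℝ H₂) u) = e u :=
    fun u => by
      rw [he]
      simp only [J, blockOp_apply]
      congr 2
      · simp
      · simp
        abel
  refine ⟨(e.symm : WithLp 2 (H₁ × H₂) →L[ℝ] WithLp 2 (H₁ × H₂)) ∘L J, ?_, ?_⟩
  · ext1 u
    simp [hJM]
  · ext1 u
    have h := hJM (e.symm (J u))
    rw [e.apply_symm_apply] at h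
    simpa [hJ] using congrArg J h
end

section
/- Suppose M₁₁ ≥ 0 and −M₂₂ ≥ 0. Then for every ε > 0 the operator M_ε is invertible and the composition M_ε⁻¹ ∘ M has operator norm at most 1; that is, ‖M_ε⁻¹(Mu)‖ ≤ ‖u‖ for all u ∈ H. -/
open scoped RealInnerProductSpace

/-- The element of the product Hilbert space `H₁ ×₂ H₂` with components `a` and `b`. -/
noncomputable def pairL2 {H₁ H₂ : Type*}
    [NormedAddCommGroup H₁] [InnerProductSpace ℝ H₁]
    [NormedAddCommGroup H₂] [InnerProductSpace ℝ H₂]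
    (a : H₁) (b : H₂) : WithLp 2 (H₁ × H₂) :=
  (WithLp.equiv 2 (H₁ × H₂)).symm (a, b)

section Helpers

variable {H₁ H₂ : Type*}
  [NormedAddCommGroup H₁] [InnerProductSpace ℝ H₁]
  [NormedAddCommGroup H₂] [InnerProductSpace ℝ H₂]

@[simp]
theorem blockOp_fst (M11 : H₁ →L[ℝ] H₁) (M12 : H₂ →L[ℝ] H₁)
    (M21 : H₁ →L[ℝ] H₂) (M22 : H₂ →L[ℝ] H₂) (u : WithLp 2 (H₁ × H₂)) :
    (blockOp M11 M12 M21 M22 u).fst = M11 u.fst + M12 u.snd := rfl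

@[simp]
theorem blockOp_snd (M11 : H₁ →L[ℝ] H₁) (M12 : H₂ →L[ℝ] H₁)
    (M21 : H₁ →L[ℝ] H₂) (M22 : H₂ →L[ℝ] H₂) (u : WithLp 2 (H₁ × H₂)) :
    (blockOp M11 M12 M21 M22 u).snd = M21 u.fst + M22 u.snd := rfl

/-- The reflection `(u₁, u₂) ↦ (u₁, -u₂)` of the product Hilbert space. -/
noncomputable def sndNegOp (H₁ H₂ : Type*)
    [NormedAddCommGroup H₁] [InnerProductSpace ℝ H₁]
    [NormedAddCommGroup H₂] [InnerProductSpace ℝ H₂] :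
    WithLp 2 (H₁ × H₂) →L[ℝ] WithLp 2 (H₁ × H₂) :=
  blockOp (ContinuousLinearMap.id ℝ H₁) 0 0 (-ContinuousLinearMap.id ℝ H₂)

theorem sndNegOp_mul_self : sndNegOp H₁ H₂ * sndNegOp H₁ H₂ = 1 := by
  refine ContinuousLinearMap.ext fun u ↦ WithLp.ofLp_injective 2 (Prod.ext ?_ ?_)
  · change (sndNegOp H₁ H₂ (sndNegOp H₁ H₂ u)).fst = u.fst
    simp [sndNegOp]
  · change (sndNegOp H₁ H₂ (sndNegOp H₁ H₂ u)).snd = u.snd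
    simp [sndNegOp]

theorem isUnit_sndNegOp : IsUnit (sndNegOp H₁ H₂) :=
  ⟨⟨_, _, sndNegOp_mul_self, sndNegOp_mul_self⟩, rfl⟩

theorem blockOp_add_smul_sndNegOp (M11 : H₁ →L[ℝ] H₁) (M12 : H₂ →L[ℝ] H₁)
    (M21 : H₁ →L[ℝ] H₂) (M22 : H₂ →L[ℝ] H₂) (ε : ℝ) :
    blockOp (M11 + ε • ContinuousLinearMap.id ℝ H₁) M12 M21
        (M22 - ε • ContinuousLinearMap.id ℝ H₂) =
      blockOp M11 M12 M21 M22 + ε • sndNegOp H₁ H₂ := by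
  refine ContinuousLinearMap.ext fun u ↦ WithLp.ofLp_injective 2 (Prod.ext ?_ ?_)
  · change M11 u.fst + ε • u.fst + M12 u.snd =
      (blockOp M11 M12 M21 M22 u + ε • sndNegOp H₁ H₂ u).fst
    simp [sndNegOp]
    abel
  · change M21 u.fst + (M22 u.snd - ε • u.snd) =
      (blockOp M11 M12 M21 M22 u + ε • sndNegOp H₁ H₂ u).snd
    simp [sndNegOp]
    abel

/-- The reflection turns a block operator with `M₁₁ ≥ 0`, `-M₂₂ ≥ 0` and `M₂₁ = M₁₂*` into an
accretive operator. -/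
theorem inner_sndNegOp_mul_blockOp_nonneg [CompleteSpace H₁] [CompleteSpace H₂]
    {M11 : H₁ →L[ℝ] H₁} (M12 : H₂ →L[ℝ] H₁) {M22 : H₂ →L[ℝ] H₂}
    (h11 : ∀ x, 0 ≤ ⟪M11 x, x⟫) (h22 : ∀ y, 0 ≤ ⟪(-M22) y, y⟫) (u : WithLp 2 (H₁ × H₂)) :
    0 ≤ ⟪(sndNegOp H₁ H₂ * blockOp M11 M12 (ContinuousLinearMap.adjoint M12) M22) u, u⟫ := by
  have h1 := h11 u.fst
  have h2 := h22 u.snd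
  have h3 : ⟪ContinuousLinearMap.adjoint M12 u.fst, u.snd⟫ = ⟪M12 u.snd, u.fst⟫ := by
    rw [ContinuousLinearMap.adjoint_inner_left, real_inner_comm]
  simp only [neg_apply, inner_neg_left] at h2
  simp [sndNegOp, WithLp.prod_inner_apply, inner_add_left, h3]
  linarith

end Helpers

section Accretive

variable {E : Type*} [NormedAddCommGroup E] [InnerProductSpace ℝ E]

theorem isUnit_add_smul_one_of_accretive [CompleteSpace E] {N : E →L[ℝ] E}
    (hN : ∀ u, 0 ≤ ⟪N u, u⟫) {ε : ℝ} (hε : 0 < ε) : IsUnit (N + ε • (1 : E →L[ℝ] E)) := by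
  refine ContinuousLinearMap.isUnit_of_forall_le_norm_inner_map _ (c := ⟨ε, hε.le⟩) hε fun u ↦ ?_
  refine le_trans ?_ (le_abs_self _)
  have := hN u
  change ‖u‖ ^ 2 * ε ≤ ⟪N u + ε • u, u⟫
  rw [inner_add_left, real_inner_smul_left, real_inner_self_eq_norm_sq]
  linarith

theorem norm_le_of_accretive_add_smul_eq {N : E →L[ℝ] E} (hN : ∀ u, 0 ≤ ⟪N u, u⟫)
    {ε : ℝ} (hε : 0 < ε) {u v : E} (h : N v + ε • v = N u) : ‖v‖ ≤ ‖u‖ := by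
  have h1 := hN (u - v)
  rw [map_sub, ← h, add_sub_cancel_left, real_inner_smul_left, inner_sub_right,
    real_inner_self_eq_norm_sq] at h1
  have h2 := nonneg_of_mul_nonneg_right h1 hε
  have h3 := real_inner_le_norm v u
  by_contra! h4
  nlinarith [norm_nonneg u, norm_nonneg v]

end Accretive

/-- If `M₁₁ ≥ 0` and `−M₂₂ ≥ 0`, then for every `ε > 0` the perturbed block operator `M_ε`
is invertible and `‖M_ε⁻¹(Mu)‖ ≤ ‖u‖` for all `u`. -/
theorem perturbed_block_operator_inverse_comp_norm_le_one {H₁ H₂ : Type*}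
    [NormedAddCommGroup H₁] [InnerProductSpace ℝ H₁] [CompleteSpace H₁]
    [NormedAddCommGroup H₂] [InnerProductSpace ℝ H₂] [CompleteSpace H₂]
    (M11 : H₁ →L[ℝ] H₁) (M12 : H₂ →L[ℝ] H₁)
    (M21 : H₁ →L[ℝ] H₂) (M22 : H₂ →L[ℝ] H₂)
    (h21 : M21 = ContinuousLinearMap.adjoint M12)
    (h11sa : IsSelfAdjoint M11) (h22sa : IsSelfAdjoint M22)
    (h11pos : ∀ u₁ : H₁, 0 ≤ ⟪M11 u₁, u₁⟫)
    (h22neg : ∀ u₂ : H₂, 0 ≤ ⟪(-M22) u₂, u₂⟫)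
    (ε : ℝ) (hε : 0 < ε) :
    ∃ S : WithLp 2 (H₁ × H₂) →L[ℝ] WithLp 2 (H₁ × H₂),
      S ∘L blockOp (M11 + ε • ContinuousLinearMap.id ℝ H₁) M12 M21
          (M22 - ε • ContinuousLinearMap.id ℝ H₂) = ContinuousLinearMap.id ℝ _ ∧
      blockOp (M11 + ε • ContinuousLinearMap.id ℝ H₁) M12 M21
          (M22 - ε • ContinuousLinearMap.id ℝ H₂) ∘L S = ContinuousLinearMap.id ℝ _ ∧
      ∀ u : WithLp 2 (H₁ × H₂), ‖S (blockOp M11 M12 M21 M22 u)‖ ≤ ‖u‖ := by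
  subst h21
  rw [blockOp_add_smul_sndNegOp]
  set M := blockOp M11 M12 (ContinuousLinearMap.adjoint M12) M22
  set J := sndNegOp H₁ H₂
  have hN : ∀ u, 0 ≤ ⟪(J * M) u, u⟫ := inner_sndNegOp_mul_blockOp_nonneg M12 h11pos h22neg
  have hJM : J * (M + ε • J) = J * M + ε • 1 := by
    rw [mul_add, ← sndNegOp_mul_self]
    exact congrArg (J * M + ·) (ContinuousLinearMap.comp_smul J ε J)
  have hunit : IsUnit (M + ε • J) := by
    rw [← isUnit_sndNegOp.unit.isUnit_units_mul, IsUnit.unit_spec, hJM]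
    exact isUnit_add_smul_one_of_accretive hN hε
  obtain ⟨S, hS⟩ := hunit
  rw [← hS]
  refine ⟨(S⁻¹ : _), S.inv_mul, S.mul_inv, fun u ↦ norm_le_of_accretive_add_smul_eq hN hε ?_⟩
  have h : (J * (M + ε • J)) * (↑S⁻¹ * M) = J * M := by
    rw [← hS, mul_assoc, S.mul_inv_cancel_left]
  rw [hJM] at h
  exact DFunLike.congr_fun h u
end

section
/- Suppose M₁₁ ≥ 0 and −M₂₂ ≥ 0, and let ε > 0. Define the block operator Ṁ_ε : H → H by Ṁ_ε(u₁,u₂) = (M₁₁u₁ + εu₁ + M₁₂u₂, −M₂₁u₁ − M₂₂u₂ + εu₂). Then Ṁ_ε is invertible and M_ε⁻¹ ∘ M = I − ε Ṁ_ε⁻¹, where I is the identity operator on H. -/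
open scoped RealInnerProductSpace

/-- A bounded operator on a real Hilbert space whose quadratic form is bounded below by a positive
multiple of the squared norm has a bounded two-sided inverse. -/
theorem ContinuousLinearMap.exists_inverse_of_coercive {V : Type*}
    [NormedAddCommGroup V] [InnerProductSpace ℝ V] [CompleteSpace V]
    (T : V →L[ℝ] V) {c : ℝ} (hc : 0 < c) (hT : ∀ u, c * ‖u‖ * ‖u‖ ≤ ⟪T u, u⟫) :
    ∃ S : V →L[ℝ] V, S ∘L T = ContinuousLinearMap.id ℝ V ∧
      T ∘L S = ContinuousLinearMap.id ℝ V := by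
  have hB : IsCoercive ((innerSL ℝ : V →L[ℝ] V →L[ℝ] ℝ) ∘L T) := ⟨c, hc, fun u => hT u⟩
  have hT' : ∀ u, T u = hB.continuousLinearEquivOfBilin u := fun u =>
    hB.unique_continuousLinearEquivOfBilin fun _ => rfl
  refine ⟨hB.continuousLinearEquivOfBilin.symm.toContinuousLinearMap, ?_, ?_⟩
  · ext u
    simp [hT']
  · ext u
    simp [hT']

section BlockOp

variable {H₁ H₂ : Type*}
  [NormedAddCommGroup H₁] [InnerProductSpace ℝ H₁]
  [NormedAddCommGroup H₂] [InnerProductSpace ℝ H₂]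

@[simp]
theorem blockOp_apply_fst (A : H₁ →L[ℝ] H₁) (B : H₂ →L[ℝ] H₁) (C : H₁ →L[ℝ] H₂)
    (D : H₂ →L[ℝ] H₂) (u : WithLp 2 (H₁ × H₂)) :
    (blockOp A B C D u).fst = A u.fst + B u.snd := rfl

@[simp]
theorem blockOp_apply_snd (A : H₁ →L[ℝ] H₁) (B : H₂ →L[ℝ] H₁) (C : H₁ →L[ℝ] H₂)
    (D : H₂ →L[ℝ] H₂) (u : WithLp 2 (H₁ × H₂)) :
    (blockOp A B C D u).snd = C u.fst + D u.snd := rfl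

theorem WithLp.prod_clm_ext {f g : WithLp 2 (H₁ × H₂) →L[ℝ] WithLp 2 (H₁ × H₂)}
    (h₁ : ∀ u, (f u).fst = (g u).fst) (h₂ : ∀ u, (f u).snd = (g u).snd) : f = g :=
  ContinuousLinearMap.ext fun u => WithLp.ofLp_injective 2 (Prod.ext (h₁ u) (h₂ u))

/-- A block operator with skew off-diagonal part and positive diagonal blocks, shifted by `ε`, is
coercive with constant `ε`. -/
theorem blockOp_skew_coercive [CompleteSpace H₁] [CompleteSpace H₂]
    (A : H₁ →L[ℝ] H₁) (B : H₂ →L[ℝ] H₁) (D : H₂ →L[ℝ] H₂)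
    (hA : ∀ u, 0 ≤ ⟪A u, u⟫) (hD : ∀ u, 0 ≤ ⟪D u, u⟫) (ε : ℝ) (u : WithLp 2 (H₁ × H₂)) :
    ε * ‖u‖ * ‖u‖ ≤ ⟪blockOp (A + ε • ContinuousLinearMap.id ℝ H₁) B
      (-ContinuousLinearMap.adjoint B) (D + ε • ContinuousLinearMap.id ℝ H₂) u, u⟫ := by
  have hskew : ⟪ContinuousLinearMap.adjoint B u.fst, u.snd⟫ = ⟪B u.snd, u.fst⟫ := by
    rw [ContinuousLinearMap.adjoint_inner_left, real_inner_comm]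
  have hnorm : ‖u‖ * ‖u‖ = ‖u.fst‖ ^ 2 + ‖u.snd‖ ^ 2 := by
    rw [← sq, WithLp.prod_norm_sq_eq_of_L2]
  rw [mul_assoc, hnorm, WithLp.prod_inner_apply]
  change _ ≤ ⟪(A u.fst + ε • u.fst) + B u.snd, u.fst⟫ +
    ⟪-ContinuousLinearMap.adjoint B u.fst + (D u.snd + ε • u.snd), u.snd⟫
  simp only [inner_add_left, inner_neg_left, real_inner_smul_left, real_inner_self_eq_norm_sq,
    hskew]
  linarith [hA u.fst, hD u.snd]

end BlockOp

/-- If `M₁₁ ≥ 0` and `−M₂₂ ≥ 0` and `ε > 0`, then the block operator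
`Ṁ_ε(u₁,u₂) = (M₁₁u₁ + εu₁ + M₁₂u₂, −M₂₁u₁ − M₂₂u₂ + εu₂)` is invertible,
`M_ε` is invertible, and `M_ε⁻¹ ∘ M = I − ε Ṁ_ε⁻¹`. -/
theorem perturbed_block_operator_inverse_comp_eq {H₁ H₂ : Type*}
    [NormedAddCommGroup H₁] [InnerProductSpace ℝ H₁] [CompleteSpace H₁]
    [NormedAddCommGroup H₂] [InnerProductSpace ℝ H₂] [CompleteSpace H₂]
    (M11 : H₁ →L[ℝ] H₁) (M12 : H₂ →L[ℝ] H₁)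
    (M21 : H₁ →L[ℝ] H₂) (M22 : H₂ →L[ℝ] H₂)
    (h21 : M21 = ContinuousLinearMap.adjoint M12)
    (h11sa : IsSelfAdjoint M11) (h22sa : IsSelfAdjoint M22)
    (h11pos : ∀ u₁ : H₁, 0 ≤ ⟪M11 u₁, u₁⟫)
    (h22neg : ∀ u₂ : H₂, 0 ≤ ⟪(-M22) u₂, u₂⟫)
    (ε : ℝ) (hε : 0 < ε) :
    ∃ S Sd : WithLp 2 (H₁ × H₂) →L[ℝ] WithLp 2 (H₁ × H₂),
      S ∘L blockOp (M11 + ε • ContinuousLinearMap.id ℝ H₁) M12 M21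
          (M22 - ε • ContinuousLinearMap.id ℝ H₂) = ContinuousLinearMap.id ℝ _ ∧
      blockOp (M11 + ε • ContinuousLinearMap.id ℝ H₁) M12 M21
          (M22 - ε • ContinuousLinearMap.id ℝ H₂) ∘L S = ContinuousLinearMap.id ℝ _ ∧
      Sd ∘L blockOp (M11 + ε • ContinuousLinearMap.id ℝ H₁) M12 (-M21)
          (-M22 + ε • ContinuousLinearMap.id ℝ H₂) = ContinuousLinearMap.id ℝ _ ∧
      blockOp (M11 + ε • ContinuousLinearMap.id ℝ H₁) M12 (-M21)
          (-M22 + ε • ContinuousLinearMap.id ℝ H₂) ∘L Sd = ContinuousLinearMap.id ℝ _ ∧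
      S ∘L blockOp M11 M12 M21 M22 = ContinuousLinearMap.id ℝ _ - ε • Sd := by
  subst h21
  obtain ⟨R, hRT, hTR⟩ := ContinuousLinearMap.exists_inverse_of_coercive _ hε
    (blockOp_skew_coercive M11 M12 (-M22) h11pos h22neg ε)
  set T := blockOp (M11 + ε • ContinuousLinearMap.id ℝ H₁) M12
    (-ContinuousLinearMap.adjoint M12) (-M22 + ε • ContinuousLinearMap.id ℝ H₂) with hT
  set J : WithLp 2 (H₁ × H₂) →L[ℝ] WithLp 2 (H₁ × H₂) :=
    blockOp (ContinuousLinearMap.id ℝ H₁) 0 0 (-ContinuousLinearMap.id ℝ H₂) with hJ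
  have hJJ : J ∘L J = ContinuousLinearMap.id ℝ _ := by
    apply WithLp.prod_clm_ext <;> intro u <;> simp [hJ]
  have hJT : blockOp (M11 + ε • ContinuousLinearMap.id ℝ H₁) M12
      (ContinuousLinearMap.adjoint M12) (M22 - ε • ContinuousLinearMap.id ℝ H₂) = J ∘L T := by
    apply WithLp.prod_clm_ext <;> intro u <;> simp [hJ, hT]
    abel
  have hJM : J ∘L blockOp M11 M12 (ContinuousLinearMap.adjoint M12) M22 =
      T - ε • ContinuousLinearMap.id ℝ _ := by
    apply WithLp.prod_clm_ext <;> intro u <;> simp [hJ, hT] <;> abel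
  refine ⟨R ∘L J, R, ?_, ?_, hRT, hTR, ?_⟩
  · rw [hJT, ContinuousLinearMap.comp_assoc, ← ContinuousLinearMap.comp_assoc J, hJJ,
      ContinuousLinearMap.id_comp, hRT]
  · rw [hJT, ContinuousLinearMap.comp_assoc, ← ContinuousLinearMap.comp_assoc T, hTR,
      ContinuousLinearMap.id_comp, hJJ]
  · rw [ContinuousLinearMap.comp_assoc, hJM, ContinuousLinearMap.comp_sub, hRT,
      ContinuousLinearMap.comp_smul, ContinuousLinearMap.comp_id]
end

section
/- Let u* = (u₁*,u₂*) ∈ H. Then u* is a saddle point of J if and only if M₁₁ ≥ 0, −M₂₂ ≥ 0, and Mu* + k = 0. -/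
open scoped RealInnerProductSpace

/-- The quadratic functional `J(u) = ⟨Mu,u⟩ + 2⟨k,u⟩ + c` on the product Hilbert space. -/
noncomputable def quadJ {H₁ H₂ : Type*}
    [NormedAddCommGroup H₁] [InnerProductSpace ℝ H₁]
    [NormedAddCommGroup H₂] [InnerProductSpace ℝ H₂]
    (M11 : H₁ →L[ℝ] H₁) (M12 : H₂ →L[ℝ] H₁)
    (M21 : H₁ →L[ℝ] H₂) (M22 : H₂ →L[ℝ] H₂)
    (k : WithLp 2 (H₁ × H₂)) (c : ℝ) (u : WithLp 2 (H₁ × H₂)) : ℝ :=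
  ⟪blockOp M11 M12 M21 M22 u, u⟫ + 2 * ⟪k, u⟫ + c

/-- `(a, b)` is a saddle point of `J : H₁ ×₂ H₂ → ℝ`:
`J(a, u₂) ≤ J(a, b) ≤ J(u₁, b)` for all `u₁ ∈ H₁`, `u₂ ∈ H₂`. -/
def IsSaddlePoint {H₁ H₂ : Type*}
    [NormedAddCommGroup H₁] [InnerProductSpace ℝ H₁]
    [NormedAddCommGroup H₂] [InnerProductSpace ℝ H₂]
    (J : WithLp 2 (H₁ × H₂) → ℝ) (a : H₁) (b : H₂) : Prop :=
  (∀ u₂ : H₂, J (pairL2 a u₂) ≤ J (pairL2 a b)) ∧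
    (∀ u₁ : H₁, J (pairL2 a b) ≤ J (pairL2 u₁ b))

/-- A real quadratic functional without constant term is nonnegative iff its quadratic part is
nonnegative and its linear part vanishes. -/
theorem forall_nonneg_inner_add_two_mul_inner_iff {E : Type*}
    [NormedAddCommGroup E] [InnerProductSpace ℝ E] (T : E →L[ℝ] E) (g : E) :
    (∀ v : E, 0 ≤ ⟪T v, v⟫ + 2 * ⟪g, v⟫) ↔ (∀ v : E, 0 ≤ ⟪T v, v⟫) ∧ g = 0 := by
  refine ⟨fun h => ⟨fun v => ?_, ?_⟩, fun ⟨h, hg⟩ v => by simpa [hg] using h v⟩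
  · have h₁ := h v
    have h₂ := h (-v)
    simp only [map_neg, inner_neg_left, inner_neg_right] at h₂
    linarith
  · have hdiscrim : discrim ⟪T g, g⟫ (2 * ⟪g, g⟫) 0 ≤ 0 := discrim_le_zero fun t => by
      have ht := h (t • g)
      simp only [map_smul, real_inner_smul_left, real_inner_smul_right] at ht
      linarith
    rw [discrim] at hdiscrim
    exact inner_self_eq_zero.mp (pow_eq_zero_iff two_ne_zero |>.mp
      (le_antisymm (by linarith) (sq_nonneg (⟪g, g⟫ : ℝ))))

theorem quadJ_pairL2 {H₁ H₂ : Type*}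
    [NormedAddCommGroup H₁] [InnerProductSpace ℝ H₁]
    [NormedAddCommGroup H₂] [InnerProductSpace ℝ H₂]
    (M11 : H₁ →L[ℝ] H₁) (M12 : H₂ →L[ℝ] H₁)
    (M21 : H₁ →L[ℝ] H₂) (M22 : H₂ →L[ℝ] H₂)
    (k : WithLp 2 (H₁ × H₂)) (c : ℝ) (a : H₁) (b : H₂) :
    quadJ M11 M12 M21 M22 k c (pairL2 a b) =
      ⟪M11 a + M12 b, a⟫ + ⟪M21 a + M22 b, b⟫ + 2 * (⟪k.fst, a⟫ + ⟪k.snd, b⟫) + c := by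
  simp [quadJ, blockOp, pairL2, WithLp.prod_inner_apply]

theorem blockOp_pairL2_add_eq_zero_iff {H₁ H₂ : Type*}
    [NormedAddCommGroup H₁] [InnerProductSpace ℝ H₁]
    [NormedAddCommGroup H₂] [InnerProductSpace ℝ H₂]
    (M11 : H₁ →L[ℝ] H₁) (M12 : H₂ →L[ℝ] H₁)
    (M21 : H₁ →L[ℝ] H₂) (M22 : H₂ →L[ℝ] H₂)
    (k : WithLp 2 (H₁ × H₂)) (a : H₁) (b : H₂) :
    blockOp M11 M12 M21 M22 (pairL2 a b) + k = 0 ↔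
      M11 a + M12 b + k.fst = 0 ∧ M21 a + M22 b + k.snd = 0 := by
  rw [← (WithLp.equiv 2 (H₁ × H₂)).injective.eq_iff, Prod.ext_iff]
  simp [blockOp, pairL2]

theorem quadJ_pairL2_add_left {H₁ H₂ : Type*}
    [NormedAddCommGroup H₁] [InnerProductSpace ℝ H₁] [CompleteSpace H₁]
    [NormedAddCommGroup H₂] [InnerProductSpace ℝ H₂] [CompleteSpace H₂]
    {M11 : H₁ →L[ℝ] H₁} (h11sa : IsSelfAdjoint M11) (M12 : H₂ →L[ℝ] H₁) (M22 : H₂ →L[ℝ] H₂)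
    (k : WithLp 2 (H₁ × H₂)) (c : ℝ) (a v : H₁) (b : H₂) :
    quadJ M11 M12 (ContinuousLinearMap.adjoint M12) M22 k c (pairL2 (a + v) b) =
      quadJ M11 M12 (ContinuousLinearMap.adjoint M12) M22 k c (pairL2 a b) +
        (⟪M11 v, v⟫ + 2 * ⟪M11 a + M12 b + k.fst, v⟫) := by
  have hsymm : ⟪M11 v, a⟫ = ⟪M11 a, v⟫ := by
    rw [real_inner_comm]
    exact (h11sa.isSymmetric a v).symm
  simp only [quadJ_pairL2, map_add, inner_add_left, inner_add_right,
    ContinuousLinearMap.adjoint_inner_left, hsymm, real_inner_comm (M12 b)]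
  ring

theorem quadJ_pairL2_add_right {H₁ H₂ : Type*}
    [NormedAddCommGroup H₁] [InnerProductSpace ℝ H₁] [CompleteSpace H₁]
    [NormedAddCommGroup H₂] [InnerProductSpace ℝ H₂] [CompleteSpace H₂]
    (M11 : H₁ →L[ℝ] H₁) (M12 : H₂ →L[ℝ] H₁) {M22 : H₂ →L[ℝ] H₂} (h22sa : IsSelfAdjoint M22)
    (k : WithLp 2 (H₁ × H₂)) (c : ℝ) (a : H₁) (b v : H₂) :
    quadJ M11 M12 (ContinuousLinearMap.adjoint M12) M22 k c (pairL2 a (b + v)) =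
      quadJ M11 M12 (ContinuousLinearMap.adjoint M12) M22 k c (pairL2 a b) +
        (⟪M22 v, v⟫ +
          2 * ⟪ContinuousLinearMap.adjoint M12 a + M22 b + k.snd, v⟫) := by
  have hsymm : ⟪M22 v, b⟫ = ⟪M22 b, v⟫ := by
    rw [real_inner_comm]
    exact (h22sa.isSymmetric b v).symm
  simp only [quadJ_pairL2, map_add, inner_add_left, inner_add_right,
    ContinuousLinearMap.adjoint_inner_left, hsymm, real_inner_comm a]
  ring

/-- `u* = (u₁*, u₂*)` is a saddle point of `J(u) = ⟨Mu,u⟩ + 2⟨k,u⟩ + c` iff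
`M₁₁ ≥ 0`, `−M₂₂ ≥ 0` and `Mu* + k = 0`. -/
theorem isSaddlePoint_iff {H₁ H₂ : Type*}
    [NormedAddCommGroup H₁] [InnerProductSpace ℝ H₁] [CompleteSpace H₁]
    [NormedAddCommGroup H₂] [InnerProductSpace ℝ H₂] [CompleteSpace H₂]
    (M11 : H₁ →L[ℝ] H₁) (M12 : H₂ →L[ℝ] H₁)
    (M21 : H₁ →L[ℝ] H₂) (M22 : H₂ →L[ℝ] H₂)
    (h21 : M21 = ContinuousLinearMap.adjoint M12)
    (h11sa : IsSelfAdjoint M11) (h22sa : IsSelfAdjoint M22)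
    (k : WithLp 2 (H₁ × H₂)) (c : ℝ) (u₁s : H₁) (u₂s : H₂) :
    IsSaddlePoint (quadJ M11 M12 M21 M22 k c) u₁s u₂s ↔
      (∀ u₁ : H₁, 0 ≤ ⟪M11 u₁, u₁⟫) ∧ (∀ u₂ : H₂, 0 ≤ ⟪(-M22) u₂, u₂⟫) ∧
        blockOp M11 M12 M21 M22 (pairL2 u₁s u₂s) + k = 0 := by
  subst h21
  have hleft : (∀ u₁ : H₁, quadJ M11 M12 (ContinuousLinearMap.adjoint M12) M22 k c
        (pairL2 u₁s u₂s) ≤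
      quadJ M11 M12 (ContinuousLinearMap.adjoint M12) M22 k c (pairL2 u₁ u₂s)) ↔
      (∀ v : H₁, 0 ≤ ⟪M11 v, v⟫) ∧ M11 u₁s + M12 u₂s + k.fst = 0 := by
    rw [← forall_nonneg_inner_add_two_mul_inner_iff, ← (Equiv.addLeft u₁s).forall_congr_right]
    simp only [Equiv.coe_addLeft, quadJ_pairL2_add_left h11sa, le_add_iff_nonneg_right]
  have hright : (∀ u₂ : H₂, quadJ M11 M12 (ContinuousLinearMap.adjoint M12) M22 k c
        (pairL2 u₁s u₂) ≤
      quadJ M11 M12 (ContinuousLinearMap.adjoint M12) M22 k c (pairL2 u₁s u₂s)) ↔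
      (∀ v : H₂, 0 ≤ ⟪(-M22) v, v⟫) ∧
        ContinuousLinearMap.adjoint M12 u₁s + M22 u₂s + k.snd = 0 := by
    rw [← neg_eq_zero (a := _ + k.snd), ← forall_nonneg_inner_add_two_mul_inner_iff,
      ← (Equiv.addLeft u₂s).forall_congr_right]
    refine forall_congr' fun v => ?_
    rw [Equiv.coe_addLeft, quadJ_pairL2_add_right M11 M12 h22sa, add_le_iff_nonpos_right,
      neg_apply, inner_neg_left, inner_neg_left, mul_neg, ← neg_add, neg_nonneg]
  rw [IsSaddlePoint, hleft, hright, blockOp_pairL2_add_eq_zero_iff]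
  tauto
end

section
/- Suppose M₁₁ ≥ 0 and −M₂₂ ≥ 0, let k ∈ H, and suppose there exists v ∈ H with Mv + k = 0. Then the family u_ε := −M_ε⁻¹k converges strongly in H as ε → 0⁺: there exists u* ∈ H such that ‖u_ε − u*‖ → 0 as ε → 0⁺, and this limit satisfies Mu* + k = 0. -/
open scoped RealInnerProductSpace

/-- A vector orthogonal to the range of a monotone bounded operator lies in its kernel. -/
theorem apply_eq_zero_of_monotone_of_mem_range_orthogonal {H : Type*}
    [NormedAddCommGroup H] [InnerProductSpace ℝ H] (A : H →L[ℝ] H)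
    (hA : ∀ x, 0 ≤ ⟪A x, x⟫) {x : H} (hx : ∀ y, ⟪A y, x⟫ = 0) : A x = 0 := by
  set n : ℝ := ⟪A x, A x⟫ with hn
  set c : ℝ := ⟪A (A x), A x⟫ with hc
  have hc0 : 0 ≤ c := hA (A x)
  have key : ∀ t : ℝ, 0 ≤ t * n + t ^ 2 * c := fun t => by
    have h := hA (x + t • A x)
    simp only [map_add, map_smul, inner_add_left, inner_add_right, real_inner_smul_left,
      real_inner_smul_right, hx, ← hn, ← hc] at h
    linarith
  have hpos : 0 < c + 1 := by linarith
  have h := key (-n / (c + 1))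
  have heq : -n / (c + 1) * n + (-n / (c + 1)) ^ 2 * c = -(n / (c + 1)) ^ 2 := by
    field_simp
    ring
  rw [heq] at h
  have hq : n / (c + 1) = 0 := pow_eq_zero_iff two_ne_zero |>.1
    (by nlinarith [sq_nonneg (n / (c + 1))])
  have hn0 : n = 0 := by
    rcases div_eq_zero_iff.1 hq with h0 | h0
    · exact h0
    · exact absurd h0 hpos.ne'
  exact inner_self_eq_zero.1 hn0

/-- Resolvent estimate for a monotone bounded operator. -/
theorem norm_mul_le_norm_apply_add_smul {H : Type*}
    [NormedAddCommGroup H] [InnerProductSpace ℝ H] (A : H →L[ℝ] H)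
    (hA : ∀ x, 0 ≤ ⟪A x, x⟫) (ε : ℝ) (x : H) : ε * ‖x‖ ≤ ‖A x + ε • x‖ := by
  rcases eq_or_ne x 0 with rfl | hx
  · simp
  · have h := real_inner_le_norm (A x + ε • x) x
    rw [inner_add_left, real_inner_smul_left, real_inner_self_eq_norm_sq] at h
    have := hA x
    exact le_of_mul_le_mul_right (by nlinarith) (norm_pos_iff.2 hx)

/-- Tikhonov regularisation of a solvable equation `A u = A v` with `A` monotone converges. -/
theorem exists_tendsto_of_monotone_regularization {H : Type*}
    [NormedAddCommGroup H] [InnerProductSpace ℝ H] [CompleteSpace H] (A : H →L[ℝ] H)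
    (hA : ∀ x, 0 ≤ ⟪A x, x⟫) (v : H) (u : ℝ → H)
    (hu : ∀ ε : ℝ, 0 < ε → A (u ε) + ε • u ε = A v) :
    ∃ w : H, A w = A v ∧ Filter.Tendsto u (nhdsWithin 0 (Set.Ioi 0)) (nhds w) := by
  set K : Submodule ℝ H := LinearMap.ker (A : H →ₗ[ℝ] H) with hK
  set R : Submodule ℝ H := LinearMap.range (A : H →ₗ[ℝ] H) with hR
  have hKclosed : IsClosed (K : Set H) := A.isClosed_ker
  have : CompleteSpace K := hKclosed.completeSpace_coe
  have hRK : Rᗮ ≤ K := fun x hx =>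
    apply_eq_zero_of_monotone_of_mem_range_orthogonal A hA fun y =>
      (Submodule.mem_orthogonal R x).1 hx _ ⟨y, rfl⟩
  set w : H := v - K.starProjection v with hw
  have hwK : w ∈ Kᗮ := K.sub_starProjection_mem_orthogonal v
  have hAw : A w = A v := by
    have : A (K.starProjection v) = 0 := K.starProjection_apply_mem v
    rw [hw, map_sub, this, sub_zero]
  have hwR : w ∈ closure (R : Set H) := by
    have h := Submodule.orthogonal_le hRK hwK
    rw [Submodule.orthogonal_orthogonal_eq_closure] at h
    exact h
  refine ⟨w, hAw, ?_⟩
  rw [Metric.tendsto_nhds]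
  intro η hη
  obtain ⟨_, ⟨z, rfl⟩, hz⟩ := Metric.mem_closure_iff.1 hwR (η / 2) (by positivity)
  rw [dist_comm, dist_eq_norm] at hz
  have hsmall : ∀ᶠ ε : ℝ in nhdsWithin 0 (Set.Ioi 0), 2 * ε * ‖z‖ < η / 2 := by
    have hcont : Filter.Tendsto (fun ε : ℝ => 2 * ε * ‖z‖) (nhds 0) (nhds 0) :=
      Continuous.tendsto' (by fun_prop) _ _ (by simp)
    exact (hcont.mono_left nhdsWithin_le_nhds).eventually_lt_const (by positivity)
  filter_upwards [hsmall, self_mem_nhdsWithin] with ε hε hε0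
  have hε0 : 0 < ε := hε0
  have heq : A (u ε - w + ε • z) + ε • (u ε - w + ε • z) = ε • ((A z - w) + ε • z) := by
    have h := hu ε hε0
    rw [← hAw] at h
    rw [map_add, map_sub, map_smul, ← h]
    module
  have hle := norm_mul_le_norm_apply_add_smul A hA ε (u ε - w + ε • z)
  rw [heq, norm_smul, Real.norm_of_nonneg hε0.le] at hle
  have hle' := le_of_mul_le_mul_left hle hε0
  have h1 : ‖A z - w + ε • z‖ ≤ ‖A z - w‖ + ε * ‖z‖ := by
    simpa [norm_smul, abs_of_pos hε0] using norm_add_le (A z - w) (ε • z)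
  have h2 : ‖u ε - w‖ ≤ ‖u ε - w + ε • z‖ + ε * ‖z‖ := by
    simpa [norm_smul, abs_of_pos hε0] using norm_sub_le (u ε - w + ε • z) (ε • z)
  have hz : ‖A z - w‖ < η / 2 := hz
  rw [dist_eq_norm]
  linarith

theorem withLp_prod_ext_iff {H₁ H₂ : Type*} {x y : WithLp 2 (H₁ × H₂)} :
    x = y ↔ x.fst = y.fst ∧ x.snd = y.snd := by
  constructor
  · rintro rfl
    exact ⟨rfl, rfl⟩
  · rintro ⟨h₁, h₂⟩
    exact (WithLp.equiv 2 (H₁ × H₂)).injective (Prod.ext h₁ h₂)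

section BlockOp

variable {H₁ H₂ : Type*}
    [NormedAddCommGroup H₁] [InnerProductSpace ℝ H₁]
    [NormedAddCommGroup H₂] [InnerProductSpace ℝ H₂]
    (M11 : H₁ →L[ℝ] H₁) (M12 : H₂ →L[ℝ] H₁)
    (M21 : H₁ →L[ℝ] H₂) (M22 : H₂ →L[ℝ] H₂)

theorem blockOp_apply_fst_s12 (x : WithLp 2 (H₁ × H₂)) :
    (blockOp M11 M12 M21 M22 x).fst = M11 x.fst + M12 x.snd := rfl

theorem blockOp_apply_snd_s12 (x : WithLp 2 (H₁ × H₂)) :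
    (blockOp M11 M12 M21 M22 x).snd = M21 x.fst + M22 x.snd := rfl

end BlockOp

/-- If `M₁₁ ≥ 0`, `−M₂₂ ≥ 0`, and the equation `Mv + k = 0` has a solution, then the
family `u_ε = −M_ε⁻¹k` converges strongly as `ε → 0⁺` to some `u*` with `Mu* + k = 0`. -/
theorem perturbed_family_tendsto_saddle {H₁ H₂ : Type*}
    [NormedAddCommGroup H₁] [InnerProductSpace ℝ H₁] [CompleteSpace H₁]
    [NormedAddCommGroup H₂] [InnerProductSpace ℝ H₂] [CompleteSpace H₂]
    (M11 : H₁ →L[ℝ] H₁) (M12 : H₂ →L[ℝ] H₁)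
    (M21 : H₁ →L[ℝ] H₂) (M22 : H₂ →L[ℝ] H₂)
    (h21 : M21 = ContinuousLinearMap.adjoint M12)
    (h11sa : IsSelfAdjoint M11) (h22sa : IsSelfAdjoint M22)
    (h11pos : ∀ u₁ : H₁, 0 ≤ ⟪M11 u₁, u₁⟫)
    (h22neg : ∀ u₂ : H₂, 0 ≤ ⟪(-M22) u₂, u₂⟫)
    (k : WithLp 2 (H₁ × H₂))
    (hsol : ∃ v : WithLp 2 (H₁ × H₂), blockOp M11 M12 M21 M22 v + k = 0)
    (u : ℝ → WithLp 2 (H₁ × H₂))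
    (hu : ∀ ε : ℝ, 0 < ε →
      blockOp (M11 + ε • ContinuousLinearMap.id ℝ H₁) M12 M21
        (M22 - ε • ContinuousLinearMap.id ℝ H₂) (u ε) = -k) :
    ∃ us : WithLp 2 (H₁ × H₂),
      blockOp M11 M12 M21 M22 us + k = 0 ∧
      Filter.Tendsto u (nhdsWithin 0 (Set.Ioi 0)) (nhds us) := by
  obtain ⟨v, hv⟩ := hsol
  have hv' := withLp_prod_ext_iff.1 hv
  simp only [WithLp.add_fst, WithLp.add_snd, WithLp.zero_fst, WithLp.zero_snd,
    blockOp_apply_fst_s12, blockOp_apply_snd_s12] at hv'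
  have hmono : ∀ x, 0 ≤ ⟪blockOp M11 M12 (-M21) (-M22) x, x⟫ := fun x => by
    have h₁ := h11pos x.fst
    have h₂ := h22neg x.snd
    have h₃ : ⟪M21 x.fst, x.snd⟫ = ⟪M12 x.snd, x.fst⟫ := by
      rw [h21, ContinuousLinearMap.adjoint_inner_left, real_inner_comm]
    rw [WithLp.prod_inner_apply]
    change 0 ≤ ⟪M11 x.fst + M12 x.snd, x.fst⟫ + ⟪(-M21) x.fst + (-M22) x.snd, x.snd⟫
    rw [inner_add_left, inner_add_left, neg_apply M21, inner_neg_left, h₃]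
    linarith
  obtain ⟨w, hw, htend⟩ := exists_tendsto_of_monotone_regularization
    (blockOp M11 M12 (-M21) (-M22)) hmono v u fun ε hε => by
      have h := withLp_prod_ext_iff.1 (hu ε hε)
      simp only [blockOp_apply_fst_s12, blockOp_apply_snd_s12, WithLp.neg_fst, WithLp.neg_snd,
        add_apply, sub_apply,
        smul_apply, ContinuousLinearMap.id_apply,
        ← eq_neg_of_add_eq_zero_left hv'.1, ← eq_neg_of_add_eq_zero_left hv'.2] at h
      rw [withLp_prod_ext_iff]
      simp only [WithLp.add_fst, WithLp.add_snd, WithLp.smul_fst, WithLp.smul_snd,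
        blockOp_apply_fst_s12, blockOp_apply_snd_s12, neg_apply]
      constructor
      · rw [← h.1]
        module
      · rw [← neg_add, ← neg_add, ← h.2]
        module
  refine ⟨w, ?_, htend⟩
  rw [withLp_prod_ext_iff] at hw ⊢
  simp only [WithLp.add_fst, WithLp.add_snd, WithLp.zero_fst, WithLp.zero_snd,
    blockOp_apply_fst_s12, blockOp_apply_snd_s12, neg_apply, ← neg_add,
    neg_inj] at hw ⊢
  rwa [hw.1, hw.2]
end

section
/- Let n, m be positive integers, T > 0, and let A, C : [0,T] → ℝ^{n×n}, B, D : [0,T] → ℝ^{n×m}, Q : [0,T] → 𝕊ⁿ, S : [0,T] → ℝ^{m×n}, R : [0,T] → 𝕊^m be bounded measurable matrix-valued functions, and let G ∈ 𝕊ⁿ. Suppose P̄, P̃ : [0,T] → 𝕊ⁿ are continuous functions such that there exists a constant c > 0 with: for almost every s ∈ [0,T], both R(s) + D(s)ᵀP̄(s)D(s) and R(s) + D(s)ᵀP̃(s)D(s) are invertible with the operator norms of their inverses bounded by c, and both P̄ and P̃ satisfy the integral form of the Riccati equation P(t) = G + ∫ₜᵀ [P(s)A(s) + A(s)ᵀP(s)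 + C(s)ᵀP(s)C(s) + Q(s) − (P(s)B(s) + C(s)ᵀP(s)D(s) + S(s)ᵀ)(R(s) + D(s)ᵀP(s)D(s))⁻¹(B(s)ᵀP(s) + D(s)ᵀP(s)C(s) + S(s))] ds for all t ∈ [0,T]. Then P̄(t) = P̃(t) for all t ∈ [0,T]. -/
open Matrix MeasureTheory

/-- The right-hand side of the Riccati equation associated with the two-person zero-sum
LQ stochastic differential game:
`PA + AᵀP + CᵀPC + Q − (PB + CᵀPD + Sᵀ)(R + DᵀPD)⁻¹(BᵀP + DᵀPC + S)` at time `s`. -/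
noncomputable def riccatiRHS {n m : ℕ}
    (A C : ℝ → Matrix (Fin n) (Fin n) ℝ)
    (B D : ℝ → Matrix (Fin n) (Fin m) ℝ)
    (Q : ℝ → Matrix (Fin n) (Fin n) ℝ)
    (S : ℝ → Matrix (Fin m) (Fin n) ℝ)
    (R : ℝ → Matrix (Fin m) (Fin m) ℝ)
    (P : Matrix (Fin n) (Fin n) ℝ) (s : ℝ) : Matrix (Fin n) (Fin n) ℝ :=
  P * A s + (A s)ᵀ * P + (C s)ᵀ * P * C s + Q s -
    (P * B s + (C s)ᵀ * P * D s + (S s)ᵀ) * (R s + (D s)ᵀ * P * D s)⁻¹ *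
      ((B s)ᵀ * P + (D s)ᵀ * P * C s + S s)

/-- The matrices `M` and `M'` have entries bounded by `a`, and their entries differ by at most
`l * δ`. -/
def EntrywiseLip {p q : ℕ} (a l δ : ℝ) (M M' : Matrix (Fin p) (Fin q) ℝ) : Prop :=
  ∀ i j, |M i j| ≤ a ∧ |M' i j| ≤ a ∧ |M i j - M' i j| ≤ l * δ

namespace EntrywiseLip

variable {p q r : ℕ} {a b l k δ : ℝ}

theorem of_const {M : Matrix (Fin p) (Fin q) ℝ} (h : ∀ i j, |M i j| ≤ a) :
    EntrywiseLip a 0 δ M M := fun i j => ⟨h i j, h i j, by simp⟩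

theorem transpose {M M' : Matrix (Fin p) (Fin q) ℝ} (h : EntrywiseLip a l δ M M') :
    EntrywiseLip a l δ Mᵀ M'ᵀ := fun i j => h j i

theorem add {M M' N N' : Matrix (Fin p) (Fin q) ℝ} (hM : EntrywiseLip a l δ M M')
    (hN : EntrywiseLip b k δ N N') : EntrywiseLip (a + b) (l + k) δ (M + N) (M' + N') := by
  intro i j
  obtain ⟨h1, h2, h3⟩ := hM i j
  obtain ⟨h4, h5, h6⟩ := hN i j
  simp only [Matrix.add_apply, abs_le] at *
  refine ⟨⟨?_, ?_⟩, ⟨?_, ?_⟩, ⟨?_, ?_⟩⟩ <;> linarith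

theorem sub {M M' N N' : Matrix (Fin p) (Fin q) ℝ} (hM : EntrywiseLip a l δ M M')
    (hN : EntrywiseLip b k δ N N') : EntrywiseLip (a + b) (l + k) δ (M - N) (M' - N') := by
  intro i j
  obtain ⟨h1, h2, h3⟩ := hM i j
  obtain ⟨h4, h5, h6⟩ := hN i j
  simp only [Matrix.sub_apply, abs_le] at *
  refine ⟨⟨?_, ?_⟩, ⟨?_, ?_⟩, ⟨?_, ?_⟩⟩ <;> linarith

theorem mul {M M' : Matrix (Fin p) (Fin q) ℝ} {N N' : Matrix (Fin q) (Fin r) ℝ}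
    (hM : EntrywiseLip a l δ M M') (hN : EntrywiseLip b k δ N N') :
    EntrywiseLip (q * (a * b)) (q * (l * b + a * k)) δ (M * N) (M' * N') := by
  have abs_sum_le : ∀ (f : Fin q → ℝ) (u : ℝ), (∀ x, |f x| ≤ u) → |∑ x, f x| ≤ q * u := by
    intro f u hf
    refine (Finset.abs_sum_le_sum_abs _ _).trans
      ((Finset.sum_le_sum fun x _ => hf x).trans ?_)
    simp
  intro i j
  simp only [Matrix.mul_apply]
  refine ⟨abs_sum_le _ _ fun x => ?_, abs_sum_le _ _ fun x => ?_, ?_⟩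
  · rw [abs_mul]
    exact mul_le_mul (hM i x).1 (hN x j).1 (abs_nonneg _) ((abs_nonneg _).trans (hM i x).1)
  · rw [abs_mul]
    exact mul_le_mul (hM i x).2.1 (hN x j).2.1 (abs_nonneg _) ((abs_nonneg _).trans (hM i x).1)
  · rw [← Finset.sum_sub_distrib, mul_assoc]
    refine abs_sum_le _ _ fun x => ?_
    obtain ⟨h1, h2, h3⟩ := hM i x
    obtain ⟨h4, h5, h6⟩ := hN x j
    calc |M i x * N x j - M' i x * N' x j|
        = |(M i x - M' i x) * N x j + M' i x * (N x j - N' x j)| := by ring_nf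
      _ ≤ |M i x - M' i x| * |N x j| + |M' i x| * |N x j - N' x j| := by
          rw [← abs_mul, ← abs_mul]; exact abs_add_le _ _
      _ ≤ l * δ * b + a * (k * δ) :=
          add_le_add (mul_le_mul h3 h4 (abs_nonneg _) ((abs_nonneg _).trans h3))
            (mul_le_mul h2 h6 (abs_nonneg _) ((abs_nonneg _).trans h2))
      _ = (l * b + a * k) * δ := by ring

theorem inv {M M' : Matrix (Fin p) (Fin p) ℝ} (h : EntrywiseLip a l δ M M')
    (hM : IsUnit M) (hM' : IsUnit M') (hb : ∀ i j, |M⁻¹ i j| ≤ b) (hb' : ∀ i j, |M'⁻¹ i j| ≤ b) :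
    EntrywiseLip b (p * (p * (0 * a + b * l) * b + p * (b * a) * 0)) δ M⁻¹ M'⁻¹ := by
  intro i j
  refine ⟨hb i j, hb' i j, ?_⟩
  have key : M⁻¹ * M * M'⁻¹ - M⁻¹ * M' * M'⁻¹ = M'⁻¹ - M⁻¹ := by
    rw [Matrix.nonsing_inv_mul _ ((Matrix.isUnit_iff_isUnit_det _).1 hM), Matrix.mul_assoc,
      Matrix.mul_nonsing_inv _ ((Matrix.isUnit_iff_isUnit_det _).1 hM'), Matrix.one_mul,
      Matrix.mul_one]
  have := (((of_const hb).mul h).mul (of_const hb') i j).2.2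
  rw [← Matrix.sub_apply, key, Matrix.sub_apply, abs_sub_comm] at this
  exact this

end EntrywiseLip

/-- On bounded data with uniformly bounded inverses of the weights, the right-hand side of the
Riccati equation is bounded and Lipschitz in `P`. -/
theorem exists_riccatiRHS_entrywiseLip (n m : ℕ) (β c : ℝ) :
    ∃ b L : ℝ, ∀ (A C : ℝ → Matrix (Fin n) (Fin n) ℝ) (B D : ℝ → Matrix (Fin n) (Fin m) ℝ)
      (Q : ℝ → Matrix (Fin n) (Fin n) ℝ) (S : ℝ → Matrix (Fin m) (Fin n) ℝ)
      (R : ℝ → Matrix (Fin m) (Fin m) ℝ) (s δ : ℝ) (P P' : Matrix (Fin n) (Fin n) ℝ),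
      (∀ i j, |A s i j| ≤ β) → (∀ i j, |C s i j| ≤ β) → (∀ i j, |B s i j| ≤ β) →
      (∀ i j, |D s i j| ≤ β) → (∀ i j, |Q s i j| ≤ β) → (∀ i j, |S s i j| ≤ β) →
      (∀ i j, |R s i j| ≤ β) → EntrywiseLip β 1 δ P P' →
      IsUnit (R s + (D s)ᵀ * P * D s) → IsUnit (R s + (D s)ᵀ * P' * D s) →
      (∀ i j, |(R s + (D s)ᵀ * P * D s)⁻¹ i j| ≤ c) →
      (∀ i j, |(R s + (D s)ᵀ * P' * D s)⁻¹ i j| ≤ c) →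
      EntrywiseLip b L δ (riccatiRHS A C B D Q S R P s) (riccatiRHS A C B D Q S R P' s) := by
  exact ⟨_, _, fun A C B D Q S R s δ P P' hA hC hB hD hQ hS hR hP hK hK' hc hc' =>
    have eA := EntrywiseLip.of_const (δ := δ) hA
    have eB := EntrywiseLip.of_const (δ := δ) hB
    have eC := EntrywiseLip.of_const (δ := δ) hC
    have eD := EntrywiseLip.of_const (δ := δ) hD
    have eQ := EntrywiseLip.of_const (δ := δ) hQ
    have eS := EntrywiseLip.of_const (δ := δ) hS
    have eR := EntrywiseLip.of_const (δ := δ) hR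
    ((((hP.mul eA).add (eA.transpose.mul hP)).add ((eC.transpose.mul hP).mul eC)).add eQ).sub
      (((((hP.mul eB).add ((eC.transpose.mul hP).mul eD)).add eS.transpose).mul
        ((eR.add ((eD.transpose.mul hP).mul eD)).inv hK hK' hc hc')).mul
        (((eB.transpose.mul hP).add ((eD.transpose.mul hP).mul eC)).add eS))⟩

section Measurability

variable {Ω : Type*} [MeasurableSpace Ω] {μ : Measure Ω} {p q r : ℕ}

theorem aestronglyMeasurable_matrix_of_entries {F : Ω → Matrix (Fin p) (Fin q) ℝ}
    (h : ∀ i j, AEMeasurable (fun x => F x i j) μ) : AEStronglyMeasurable F μ :=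
  (aemeasurable_pi_lambda (fun x i j => F x i j)
    fun i => aemeasurable_pi_lambda _ fun j => h i j).aestronglyMeasurable

theorem aestronglyMeasurable_matrix_mul {F : Ω → Matrix (Fin p) (Fin q) ℝ}
    {H : Ω → Matrix (Fin q) (Fin r) ℝ} (hF : AEStronglyMeasurable F μ)
    (hH : AEStronglyMeasurable H μ) : AEStronglyMeasurable (fun x => F x * H x) μ :=
  (continuous_fst.matrix_mul continuous_snd).comp_aestronglyMeasurable (hF.prodMk hH)

theorem aestronglyMeasurable_matrix_transpose {F : Ω → Matrix (Fin p) (Fin q) ℝ}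
    (hF : AEStronglyMeasurable F μ) : AEStronglyMeasurable (fun x => (F x)ᵀ) μ :=
  continuous_id.matrix_transpose.comp_aestronglyMeasurable hF

theorem aestronglyMeasurable_matrix_inv {F : Ω → Matrix (Fin p) (Fin p) ℝ}
    (hF : AEStronglyMeasurable F μ) : AEStronglyMeasurable (fun x => (F x)⁻¹) μ := by
  simp only [Matrix.inv_def, Ring.inverse_eq_inv']
  exact (continuous_id.matrix_det.comp_aestronglyMeasurable hF).aemeasurable.inv
    |>.aestronglyMeasurable.smul (continuous_id.matrix_adjugate.comp_aestronglyMeasurable hF)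

end Measurability

/-- A nonnegative continuous function dominated by a multiple of its backward integral vanishes. -/
theorem eq_zero_of_le_mul_integral_Ioc {T K : ℝ} {N : ℝ → ℝ} (hK : 0 < K)
    (hN : ContinuousOn N (Set.Icc 0 T)) (hN0 : ∀ t ∈ Set.Icc 0 T, 0 ≤ N t)
    (hle : ∀ t ∈ Set.Icc 0 T, N t ≤ K * ∫ s in Set.Ioc t T, N s) :
    ∀ t ∈ Set.Icc 0 T, N t = 0 := by
  intro t ht
  obtain ⟨t₀, ht₀, hmax⟩ := isCompact_Icc.exists_isMaxOn ⟨t, ht⟩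
    ((Real.continuous_exp.comp (continuous_const.mul continuous_id)).continuousOn.mul hN :
      ContinuousOn (fun s => Real.exp (2 * K * s) * N s) (Set.Icc 0 T))
  set M := Real.exp (2 * K * t₀) * N t₀
  have hbound : ∀ s ∈ Set.Icc 0 T, N s ≤ M * Real.exp (-(2 * K) * s) := by
    intro s hs
    have h : Real.exp (2 * K * s) * N s ≤ M := hmax hs
    calc N s = Real.exp (2 * K * s) * N s * Real.exp (-(2 * K) * s) := by
          rw [mul_right_comm, ← Real.exp_add]; simp
      _ ≤ _ := mul_le_mul_of_nonneg_right h (Real.exp_pos _).le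
  have hsub : Set.Ioc t₀ T ⊆ Set.Icc 0 T := fun s hs => ⟨ht₀.1.trans hs.1.le, hs.2⟩
  have hint : ∫ s in Set.Ioc t₀ T, Real.exp (-(2 * K) * s) =
      (Real.exp (-(2 * K) * t₀) - Real.exp (-(2 * K) * T)) / (2 * K) := by
    rw [← intervalIntegral.integral_of_le ht₀.2,
      intervalIntegral.integral_comp_mul_left Real.exp (by linarith : -(2 * K) ≠ 0), integral_exp, smul_eq_mul]
    field_simp
    ring
  have hexp : IntegrableOn (fun s => M * Real.exp (-(2 * K) * s)) (Set.Ioc t₀ T) :=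
    (by fun_prop : Continuous fun s => M * Real.exp (-(2 * K) * s)).integrableOn_Ioc
  have hmono : ∫ s in Set.Ioc t₀ T, N s ≤ ∫ s in Set.Ioc t₀ T, M * Real.exp (-(2 * K) * s) :=
    setIntegral_mono_on ((hN.integrableOn_compact isCompact_Icc).mono_set hsub) hexp
      measurableSet_Ioc fun s hs => hbound s (hsub hs)
  rw [integral_const_mul, hint] at hmono
  have hM0 : 0 ≤ M := mul_nonneg (Real.exp_pos _).le (hN0 t₀ ht₀)
  have hhalf : N t₀ ≤ M * Real.exp (-(2 * K) * t₀) / 2 := by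
    calc N t₀ ≤ K * (M * ((Real.exp (-(2 * K) * t₀) - Real.exp (-(2 * K) * T)) / (2 * K))) :=
          (hle t₀ ht₀).trans (mul_le_mul_of_nonneg_left hmono hK.le)
      _ = M * Real.exp (-(2 * K) * t₀) / 2 - M * Real.exp (-(2 * K) * T) / 2 := by
          field_simp
      _ ≤ _ := sub_le_self _ (by positivity)
  have hMle : M ≤ M / 2 := by
    calc M ≤ Real.exp (2 * K * t₀) * (M * Real.exp (-(2 * K) * t₀) / 2) :=
          mul_le_mul_of_nonneg_left hhalf (Real.exp_pos _).le
      _ = M / 2 * (Real.exp (2 * K * t₀) * Real.exp (-(2 * K) * t₀)) := by ring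
      _ = M / 2 := by rw [← Real.exp_add]; simp
  refine le_antisymm ((hbound t ht).trans ?_) (hN0 t ht)
  rw [show M = 0 by linarith, zero_mul]

/-- Uniqueness of strongly regular solutions of the Riccati equation: two continuous
symmetric-matrix-valued solutions of the integral form of the Riccati equation whose
feedback-weight matrices `R + DᵀPD` are a.e. invertible with uniformly bounded inverses
must coincide on `[0,T]`. -/
theorem riccati_strongly_regular_solution_unique {n m : ℕ} (hn : 0 < n) (hm : 0 < m)
    (T : ℝ) (hT : 0 < T)
    (A C : ℝ → Matrix (Fin n) (Fin n) ℝ)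
    (B D : ℝ → Matrix (Fin n) (Fin m) ℝ)
    (Q : ℝ → Matrix (Fin n) (Fin n) ℝ)
    (S : ℝ → Matrix (Fin m) (Fin n) ℝ)
    (R : ℝ → Matrix (Fin m) (Fin m) ℝ)
    (G : Matrix (Fin n) (Fin n) ℝ) (hG : G.IsSymm)
    (hAmeas : ∀ i j, Measurable fun s => A s i j)
    (hCmeas : ∀ i j, Measurable fun s => C s i j)
    (hBmeas : ∀ i j, Measurable fun s => B s i j)
    (hDmeas : ∀ i j, Measurable fun s => D s i j)
    (hQmeas : ∀ i j, Measurable fun s => Q s i j)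
    (hSmeas : ∀ i j, Measurable fun s => S s i j)
    (hRmeas : ∀ i j, Measurable fun s => R s i j)
    (hbd : ∃ Cb : ℝ, ∀ s ∈ Set.Icc (0 : ℝ) T,
      (∀ i j, |A s i j| ≤ Cb) ∧ (∀ i j, |C s i j| ≤ Cb) ∧ (∀ i j, |B s i j| ≤ Cb) ∧
      (∀ i j, |D s i j| ≤ Cb) ∧ (∀ i j, |Q s i j| ≤ Cb) ∧ (∀ i j, |S s i j| ≤ Cb) ∧
      (∀ i j, |R s i j| ≤ Cb))
    (hQsymm : ∀ s, (Q s).IsSymm) (hRsymm : ∀ s, (R s).IsSymm)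
    (Pb Pt : ℝ → Matrix (Fin n) (Fin n) ℝ)
    (hPbcont : ∀ i j, ContinuousOn (fun t => Pb t i j) (Set.Icc (0 : ℝ) T))
    (hPtcont : ∀ i j, ContinuousOn (fun t => Pt t i j) (Set.Icc (0 : ℝ) T))
    (hPbsymm : ∀ t ∈ Set.Icc (0 : ℝ) T, (Pb t).IsSymm)
    (hPtsymm : ∀ t ∈ Set.Icc (0 : ℝ) T, (Pt t).IsSymm)
    (c : ℝ) (hc : 0 < c)
    (hreg : ∀ᵐ s ∂(volume.restrict (Set.Icc (0 : ℝ) T)),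
      (IsUnit (R s + (D s)ᵀ * Pb s * D s) ∧
        ∀ i j, |(R s + (D s)ᵀ * Pb s * D s)⁻¹ i j| ≤ c) ∧
      (IsUnit (R s + (D s)ᵀ * Pt s * D s) ∧
        ∀ i j, |(R s + (D s)ᵀ * Pt s * D s)⁻¹ i j| ≤ c))
    (hPbeq : ∀ t ∈ Set.Icc (0 : ℝ) T, ∀ i j,
      Pb t i j = G i j + ∫ s in Set.Ioc t T, riccatiRHS A C B D Q S R (Pb s) s i j)
    (hPteq : ∀ t ∈ Set.Icc (0 : ℝ) T, ∀ i j,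
      Pt t i j = G i j + ∫ s in Set.Ioc t T, riccatiRHS A C B D Q S R (Pt s) s i j) :
    ∀ t ∈ Set.Icc (0 : ℝ) T, Pb t = Pt t := by
  obtain ⟨Cb, hCb⟩ := hbd
  have hbounded : ∀ P : ℝ → Matrix (Fin n) (Fin n) ℝ,
      (∀ i j, ContinuousOn (fun t => P t i j) (Set.Icc 0 T)) →
      ∃ β, ∀ t ∈ Set.Icc 0 T, ∀ i j, |P t i j| ≤ β := by
    intro P hP
    choose β hβ using fun i j => isCompact_Icc.exists_bound_of_continuousOn (hP i j)
    obtain ⟨β', hβ'⟩ := (Set.finite_range fun x : Fin n × Fin n => β x.1 x.2).bddAbove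
    exact ⟨β', fun t ht i j => (hβ i j t ht).trans (hβ' ⟨(i, j), rfl⟩)⟩
  obtain ⟨βb, hβb⟩ := hbounded Pb hPbcont
  obtain ⟨βt, hβt⟩ := hbounded Pt hPtcont
  set β := max Cb (max βb βt)
  have hCβ : Cb ≤ β := le_max_left _ _
  have hbβ : βb ≤ β := (le_max_left _ _).trans (le_max_right _ _)
  have htβ : βt ≤ β := (le_max_right _ _).trans (le_max_right _ _)
  set N : ℝ → ℝ := fun t => ∑ i, ∑ j, |Pb t i j - Pt t i j|
  have hNcont : ContinuousOn N (Set.Icc 0 T) :=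
    continuousOn_finsetSum _ fun i _ => continuousOn_finsetSum _ fun j _ =>
      ((hPbcont i j).sub (hPtcont i j)).abs
  have hNentry : ∀ t i j, |Pb t i j - Pt t i j| ≤ N t := fun t i j =>
    (Finset.single_le_sum (f := fun j => |Pb t i j - Pt t i j|)
      (fun _ _ => abs_nonneg _) (Finset.mem_univ j)).trans
    (Finset.single_le_sum (f := fun i => ∑ j, |Pb t i j - Pt t i j|)
      (fun _ _ => Finset.sum_nonneg fun _ _ => abs_nonneg _) (Finset.mem_univ i))
  have hN0 : ∀ t, 0 ≤ N t := fun t =>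
    Finset.sum_nonneg fun _ _ => Finset.sum_nonneg fun _ _ => abs_nonneg _
  obtain ⟨b, L, hbL⟩ := exists_riccatiRHS_entrywiseLip n m β c
  have hlip : ∀ᵐ s ∂(volume.restrict (Set.Icc (0 : ℝ) T)), EntrywiseLip b L (N s)
      (riccatiRHS A C B D Q S R (Pb s) s) (riccatiRHS A C B D Q S R (Pt s) s) := by
    filter_upwards [hreg, ae_restrict_mem measurableSet_Icc] with s hs hsT
    obtain ⟨hA, hC, hB, hD, hQ, hS, hR⟩ := hCb s hsT
    exact hbL A C B D Q S R s (N s) (Pb s) (Pt s) (fun i j => (hA i j).trans hCβ)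
      (fun i j => (hC i j).trans hCβ) (fun i j => (hB i j).trans hCβ)
      (fun i j => (hD i j).trans hCβ) (fun i j => (hQ i j).trans hCβ)
      (fun i j => (hS i j).trans hCβ) (fun i j => (hR i j).trans hCβ)
      (fun i j => ⟨(hβb s hsT i j).trans hbβ, (hβt s hsT i j).trans htβ, by
        rw [one_mul]; exact hNentry s i j⟩) hs.1.1 hs.2.1 hs.1.2 hs.2.2
  have hmeas : ∀ P : ℝ → Matrix (Fin n) (Fin n) ℝ,
      (∀ i j, ContinuousOn (fun t => P t i j) (Set.Icc 0 T)) → ∀ i j,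
      AEStronglyMeasurable (fun s => riccatiRHS A C B D Q S R (P s) s i j)
        (volume.restrict (Set.Icc 0 T)) := by
    intro P hP i j
    have mP := aestronglyMeasurable_matrix_of_entries fun i j =>
      (hP i j).aemeasurable (μ := volume) measurableSet_Icc
    have mA := aestronglyMeasurable_matrix_of_entries (μ := volume.restrict (Set.Icc 0 T))
      fun i j => (hAmeas i j).aemeasurable
    have mB := aestronglyMeasurable_matrix_of_entries (μ := volume.restrict (Set.Icc 0 T))
      fun i j => (hBmeas i j).aemeasurable
    have mC := aestronglyMeasurable_matrix_of_entries (μ := volume.restrict (Set.Icc 0 T))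
      fun i j => (hCmeas i j).aemeasurable
    have mD := aestronglyMeasurable_matrix_of_entries (μ := volume.restrict (Set.Icc 0 T))
      fun i j => (hDmeas i j).aemeasurable
    have mQ := aestronglyMeasurable_matrix_of_entries (μ := volume.restrict (Set.Icc 0 T))
      fun i j => (hQmeas i j).aemeasurable
    have mS := aestronglyMeasurable_matrix_of_entries (μ := volume.restrict (Set.Icc 0 T))
      fun i j => (hSmeas i j).aemeasurable
    have mR := aestronglyMeasurable_matrix_of_entries (μ := volume.restrict (Set.Icc 0 T))
      fun i j => (hRmeas i j).aemeasurable
    have mAt := aestronglyMeasurable_matrix_transpose mA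
    have mBt := aestronglyMeasurable_matrix_transpose mB
    have mCt := aestronglyMeasurable_matrix_transpose mC
    have mDt := aestronglyMeasurable_matrix_transpose mD
    have mSt := aestronglyMeasurable_matrix_transpose mS
    have mCtP := aestronglyMeasurable_matrix_mul mCt mP
    have mDtP := aestronglyMeasurable_matrix_mul mDt mP
    have mLin := (((aestronglyMeasurable_matrix_mul mP mA).add
      (aestronglyMeasurable_matrix_mul mAt mP)).add
      (aestronglyMeasurable_matrix_mul mCtP mC)).add mQ
    have mLeft := ((aestronglyMeasurable_matrix_mul mP mB).add
      (aestronglyMeasurable_matrix_mul mCtP mD)).add mSt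
    have mInv := aestronglyMeasurable_matrix_inv
      (mR.add (aestronglyMeasurable_matrix_mul mDtP mD))
    have mRight := ((aestronglyMeasurable_matrix_mul mBt mP).add
      (aestronglyMeasurable_matrix_mul mDtP mC)).add mS
    have mAll := mLin.sub
      (aestronglyMeasurable_matrix_mul (aestronglyMeasurable_matrix_mul mLeft mInv) mRight)
    exact (continuous_id.matrix_elem i j).comp_aestronglyMeasurable mAll
  have hib : ∀ i j, IntegrableOn (fun s => riccatiRHS A C B D Q S R (Pb s) s i j)
      (Set.Icc 0 T) := fun i j =>
    Integrable.of_bound (hmeas Pb hPbcont i j) b (hlip.mono fun s hs => (hs i j).1)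
  have hit : ∀ i j, IntegrableOn (fun s => riccatiRHS A C B D Q S R (Pt s) s i j)
      (Set.Icc 0 T) := fun i j =>
    Integrable.of_bound (hmeas Pt hPtcont i j) b (hlip.mono fun s hs => (hs i j).2.1)
  have hentry : ∀ t ∈ Set.Icc 0 T, ∀ i j,
      |Pb t i j - Pt t i j| ≤ L * ∫ s in Set.Ioc t T, N s := by
    intro t ht i j
    have hsub : Set.Ioc t T ⊆ Set.Icc 0 T := fun s hs => ⟨ht.1.trans hs.1.le, hs.2⟩
    rw [hPbeq t ht, hPteq t ht, add_sub_add_left_eq_sub,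
      ← integral_sub ((hib i j).mono_set hsub) ((hit i j).mono_set hsub), ← integral_const_mul,
      ← Real.norm_eq_abs]
    have hNint : IntegrableOn N (Set.Icc 0 T) := hNcont.integrableOn_compact isCompact_Icc
    refine norm_integral_le_of_norm_le ((hNint.mono_set hsub).const_mul L) ?_
    filter_upwards [ae_restrict_of_ae_restrict_of_subset hsub hlip] with s hs
    exact (hs i j).2.2
  have hzero := eq_zero_of_le_mul_integral_Ioc (K := n * (n * |L|) + 1) (by positivity) hNcont
    (fun t _ => hN0 t) fun t ht => by
      have hI : 0 ≤ ∫ s in Set.Ioc t T, N s := integral_nonneg hN0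
      calc N t ≤ ∑ _i : Fin n, ∑ _j : Fin n, |L| * ∫ s in Set.Ioc t T, N s :=
            Finset.sum_le_sum fun i _ => Finset.sum_le_sum fun j _ =>
              (hentry t ht i j).trans (mul_le_mul_of_nonneg_right (le_abs_self L) hI)
        _ = (n * (n * |L|)) * ∫ s in Set.Ioc t T, N s := by simp; ring
        _ ≤ _ := mul_le_mul_of_nonneg_right (by linarith) hI
  intro t ht
  ext i j
  have h := hNentry t i j
  rw [hzero t ht] at h
  exact sub_eq_zero.1 (abs_eq_zero.1 (le_antisymm h (abs_nonneg _)))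
end
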